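/- (Configuration H(7,17)) Let Z be a set of 7 points in the complex projective plane ℙ² forming the following configuration: a line ℓ containing exactly four of the points, among them three points Q₁, Q₂, C; a point P not on ℓ; a point A on the line PQ₁ with A ∉ {P, Q₁} and A ∉ ℓ; a point B on the line PQ₂ with B ∉ {P, Q₂} and B ∉ ℓ; the points A, B, C are collinear; and the only triples of collinear points among the seven are those contained in ℓ, in the line through P, Q₁, A, in the line through P, Q₂, B, and in the line through A, B, C. Let I be the radical homogeneous ideal of Z. Then α̂(I) = 16/7; moreover, the first differences of the initial sequence of I are periodic with period (3,2,2,3,2,2,2): for every k ≥ 0 one has α(I^(7k+1)) = 16k + 3, α(I^(7k+2)) = 16k + 5, α(I^(7k+3)) = 16k + 7, α(I^(7k+4)) = 16k + 10, α(I^(7k+5)) = 16k + 12, α(I^(7k+6)) = 16k + 14, and α(I^(7k+7)) = 16k + 16. -/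

import Mathlib

open scoped LinearAlgebra.Projectivization

/-- A polynomial `F` vanishes to order at least `m` at the (affine representative) point
`v`: all iterated partial derivatives of order `≤ m - 1` (i.e. of order `< m`) vanish at `v`. -/
def VanishesToOrder (m : ℕ) (F : MvPolynomial (Fin 3) ℂ) (v : Fin 3 → ℂ) : Prop :=
  ∀ k : ℕ, k < m → ∀ d : Fin k → Fin 3,
    MvPolynomial.eval v ((List.ofFn d).foldl (fun p i => MvPolynomial.pderiv i p) F) = 0

/-- The `m`-th symbolic power of the (radical) ideal of a set `Z` of points of `ℙ²`:
all polynomials vanishing to order at least `m` at every point of `Z`. -/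
def symbolicPower (Z : Set (ℙ ℂ (Fin 3 → ℂ))) (m : ℕ) : Set (MvPolynomial (Fin 3) ℂ) :=
  {F | ∀ P ∈ Z, ∀ (v : Fin 3 → ℂ) (hv : v ≠ 0),
    Projectivization.mk ℂ v hv = P → VanishesToOrder m F v}

/-- The initial degree `α` of a set of polynomials: the least `t` such that the set contains
a nonzero homogeneous polynomial of degree `t`. -/
noncomputable def initialDegree (S : Set (MvPolynomial (Fin 3) ℂ)) : ℕ :=
  sInf {t | ∃ F ∈ S, F ≠ 0 ∧ F.IsHomogeneous t}

/-- The Waldschmidt constant `α̂(I) = inf_{m ≥ 1} α(I^(m))/m` of the radical ideal of `Z`. -/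
noncomputable def waldschmidt (Z : Set (ℙ ℂ (Fin 3 → ℂ))) : ℝ :=
  ⨅ m : ℕ+, (initialDegree (symbolicPower Z (m : ℕ)) : ℝ) / ((m : ℕ) : ℝ)

/-- A (homogeneous equation of a) line in `ℙ²`: a nonzero homogeneous polynomial of degree 1. -/
def IsLine (L : MvPolynomial (Fin 3) ℂ) : Prop := L ≠ 0 ∧ L.IsHomogeneous 1

/-- The point `x ∈ ℙ²` lies on the line (or curve) with equation `L`. -/
def MemLine (L : MvPolynomial (Fin 3) ℂ) (x : ℙ ℂ (Fin 3 → ℂ)) : Prop :=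
  ∀ (v : Fin 3 → ℂ) (hv : v ≠ 0), Projectivization.mk ℂ v hv = x → MvPolynomial.eval v L = 0

/-- Three points of `ℙ²` are collinear if some line contains all of them. -/
def Collin (x y z : ℙ ℂ (Fin 3 → ℂ)) : Prop :=
  ∃ M, IsLine M ∧ MemLine M x ∧ MemLine M y ∧ MemLine M z

/-- `Z` is contained in a conic: the zero set of a nonzero homogeneous polynomial of degree 2
(possibly degenerate). -/
def ContainedInConic (Z : Set (ℙ ℂ (Fin 3 → ℂ))) : Prop :=
  ∃ F : MvPolynomial (Fin 3) ℂ, F ≠ 0 ∧ F.IsHomogeneous 2 ∧ ∀ x ∈ Z, MemLine F x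

/-- The configuration of points consisting of: a line `L` containing exactly `t` points of `Z`,
among them three points `Q₁, Q₂, C`; a point `P ∈ Z` not on `L`; a point `A ∈ Z` on the line
`L₁` through `P` and `Q₁`, with `A ∉ {P, Q₁}` and `A` off `L`; a point `B ∈ Z` on the line `L₂`
through `P` and `Q₂`, with `B ∉ {P, Q₂}` and `B` off `L`; the points `A, B, C` collinear (on a
line `L₃`); and the only triples of collinear points of `Z` are those contained in one of the
lines `L`, `L₁`, `L₂`, `L₃`. -/
def StandardConfig (t : ℕ) (Z : Set (ℙ ℂ (Fin 3 → ℂ))) : Prop :=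
  ∃ L L₁ L₂ L₃ : MvPolynomial (Fin 3) ℂ, ∃ Q₁ Q₂ C P A B : ℙ ℂ (Fin 3 → ℂ),
    IsLine L ∧ IsLine L₁ ∧ IsLine L₂ ∧ IsLine L₃ ∧
    Q₁ ∈ Z ∧ Q₂ ∈ Z ∧ C ∈ Z ∧ P ∈ Z ∧ A ∈ Z ∧ B ∈ Z ∧
    Q₁ ≠ Q₂ ∧ Q₁ ≠ C ∧ Q₂ ≠ C ∧
    MemLine L Q₁ ∧ MemLine L Q₂ ∧ MemLine L C ∧
    (Z ∩ {x | MemLine L x}).ncard = t ∧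
    ¬ MemLine L P ∧
    MemLine L₁ P ∧ MemLine L₁ Q₁ ∧ MemLine L₁ A ∧ A ≠ P ∧ A ≠ Q₁ ∧ ¬ MemLine L A ∧
    MemLine L₂ P ∧ MemLine L₂ Q₂ ∧ MemLine L₂ B ∧ B ≠ P ∧ B ≠ Q₂ ∧ ¬ MemLine L B ∧
    MemLine L₃ A ∧ MemLine L₃ B ∧ MemLine L₃ C ∧
    (∀ X Y W, X ∈ Z → Y ∈ Z → W ∈ Z → X ≠ Y → X ≠ W → Y ≠ W → Collin X Y W →
      ((MemLine L X ∧ MemLine L Y ∧ MemLine L W) ∨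
       (MemLine L₁ X ∧ MemLine L₁ Y ∧ MemLine L₁ W) ∨
       (MemLine L₂ X ∧ MemLine L₂ Y ∧ MemLine L₂ W) ∨
       (MemLine L₃ X ∧ MemLine L₃ Y ∧ MemLine L₃ W)))


open MvPolynomial

section Vanishing

variable {m n : ℕ} {F G L : MvPolynomial (Fin 3) ℂ} {v : Fin 3 → ℂ}

lemma VanishesToOrder.mono (h : VanishesToOrder n F v) (hmn : m ≤ n) : VanishesToOrder m F v :=
  fun k hk d => h k (hk.trans_le hmn) d

lemma vanishesToOrder_zero : VanishesToOrder 0 F v :=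
  fun _ hk => absurd hk (Nat.not_lt_zero _)

lemma vanishesToOrder_succ :
    VanishesToOrder (n + 1) F v ↔ eval v F = 0 ∧ ∀ i, VanishesToOrder n (pderiv i F) v := by
  constructor
  · refine fun h => ⟨by simpa using h 0 n.succ_pos Fin.elim0, fun i k hk d => ?_⟩
    simpa [List.ofFn_succ] using h (k + 1) (by omega) (Fin.cons i d)
  · rintro ⟨h0, h⟩ k hk d
    cases k with
    | zero => simpa using h0
    | succ k =>
      rw [List.ofFn_succ, List.foldl_cons]
      exact h (d 0) k (by omega) fun j => d j.succ

lemma VanishesToOrder.pderiv (h : VanishesToOrder n F v) (i : Fin 3) :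
    VanishesToOrder (n - 1) (pderiv i F) v := by
  cases n with
  | zero => exact vanishesToOrder_zero
  | succ n => exact (vanishesToOrder_succ.1 h).2 i

lemma VanishesToOrder.eval_eq_zero (h : VanishesToOrder n F v) (hn : n ≠ 0) : eval v F = 0 := by
  obtain ⟨n, rfl⟩ := Nat.exists_eq_succ_of_ne_zero hn
  exact (vanishesToOrder_succ.1 h).1

lemma VanishesToOrder.add (hF : VanishesToOrder n F v) (hG : VanishesToOrder n G v) :
    VanishesToOrder n (F + G) v := by
  induction n generalizing F G with
  | zero => exact vanishesToOrder_zero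
  | succ n ih =>
    rw [vanishesToOrder_succ] at hF hG ⊢
    refine ⟨by simp [hF.1, hG.1], fun i => ?_⟩
    rw [map_add]
    exact ih (hF.2 i) (hG.2 i)

lemma VanishesToOrder.mul (hF : VanishesToOrder m F v) (hG : VanishesToOrder n G v) :
    VanishesToOrder (m + n) (F * G) v := by
  induction hk : m + n generalizing m n F G with
  | zero => exact vanishesToOrder_zero
  | succ k ih =>
    refine vanishesToOrder_succ.2 ⟨?_, fun i => ?_⟩
    · rcases eq_or_ne m 0 with rfl | hm
      · simp [hG.eval_eq_zero (by omega)]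
      · simp [hF.eval_eq_zero hm]
    · rw [pderiv_mul]
      apply VanishesToOrder.add
      · rcases eq_or_ne m 0 with rfl | hm
        · exact ih vanishesToOrder_zero (hG.mono (show k ≤ n by omega)) (by omega)
        · exact ih (hF.pderiv i) hG (by omega)
      · rcases eq_or_ne n 0 with rfl | hn
        · exact ih (hF.mono (show k ≤ m by omega)) vanishesToOrder_zero (by omega)
        · exact ih hF (hG.pderiv i) (by omega)

lemma VanishesToOrder.pow (hF : VanishesToOrder m F v) (e : ℕ) :
    VanishesToOrder (e * m) (F ^ e) v := by
  induction e with
  | zero => simpa using vanishesToOrder_zero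
  | succ e ih => simpa [pow_succ, add_mul] using ih.mul hF

lemma VanishesToOrder.prod {κ : Type*} (s : Finset κ) {f : κ → MvPolynomial (Fin 3) ℂ}
    {e : κ → ℕ} (h : ∀ j ∈ s, VanishesToOrder (e j) (f j) v) :
    VanishesToOrder (∑ j ∈ s, e j) (∏ j ∈ s, f j) v := by
  induction s using Finset.cons_induction with
  | empty => simpa using vanishesToOrder_zero
  | cons a s ha ih =>
    rw [Finset.sum_cons, Finset.prod_cons]
    exact (h a (by simp)).mul (ih fun j hj => h j (by simp [hj]))

/-- The expansion `F (v + T • w)` of `F` at `v`, as a polynomial in `T` whose coefficients are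
polynomials in the coordinates of `w`. -/
noncomputable def expansionAt (v : Fin 3 → ℂ) :
    MvPolynomial (Fin 3) ℂ →ₐ[ℂ] Polynomial (MvPolynomial (Fin 3) ℂ) :=
  aeval fun i => Polynomial.C (C (v i)) + Polynomial.X * Polynomial.C (X i)

lemma coeff_zero_expansionAt : (expansionAt v F).coeff 0 = C (eval v F) := by
  have : (Polynomial.constantCoeff.comp (expansionAt v).toRingHom) = C.comp (eval v) := by
    ext i : 2 <;> simp [expansionAt]
  exact DFunLike.congr_fun this F

lemma derivative_expansionAt : Polynomial.derivative (expansionAt v F) =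
    ∑ i, Polynomial.C (X i) * expansionAt v (pderiv i F) := by
  induction F using MvPolynomial.induction_on with
  | C a => simp [expansionAt]
  | add p q hp hq => simp [hp, hq, mul_add, Finset.sum_add_distrib]
  | mul_X p j hp =>
    rw [map_mul, Polynomial.derivative_mul, hp]
    simp only [pderiv_mul, map_add, map_mul, mul_add, Finset.sum_add_distrib, Finset.sum_mul]
    refine congr_arg₂ (· + ·) ?_ ?_
    · simp only [mul_assoc]
    · rw [Finset.sum_eq_single j (fun i _ hi => by simp [pderiv_X_of_ne hi.symm]) (by simp)]
      simp only [expansionAt, aeval_X, pderiv_X_self, map_one, mul_one, Polynomial.derivative_mul,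
        Polynomial.derivative_add, Polynomial.derivative_C, Polynomial.derivative_X]
      ring

lemma VanishesToOrder.X_pow_dvd_expansionAt (h : VanishesToOrder n F v) :
    Polynomial.X ^ n ∣ expansionAt v F := by
  induction n generalizing F with
  | zero => simp
  | succ n ih =>
    rw [vanishesToOrder_succ] at h
    have hd : Polynomial.X ^ n ∣ Polynomial.derivative (expansionAt v F) := by
      rw [derivative_expansionAt]
      exact Finset.dvd_sum fun i _ => (ih (h.2 i)).mul_left _
    rw [Polynomial.X_pow_dvd_iff] at hd ⊢
    intro k hk
    cases k with
    | zero => rw [coeff_zero_expansionAt, h.1, map_zero]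
    | succ k =>
      have := hd k (by omega)
      rw [Polynomial.coeff_derivative] at this
      exact (mul_eq_zero.1 this).resolve_right (by exact_mod_cast k.succ_ne_zero)

lemma IsLine.exists_eq_linear (hL : IsLine L) :
    ∃ a : Fin 3 → ℂ, a ≠ 0 ∧ L = ∑ i, C (a i) * X i := by
  have h := (mem_homogeneousSubmodule 1 L).2 hL.2
  rw [homogeneousSubmodule_one_eq_span_X, Submodule.mem_span_range_iff_exists_fun] at h
  obtain ⟨a, rfl⟩ := h
  refine ⟨a, ?_, by simp [smul_eq_C_mul]⟩
  rintro rfl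
  exact hL.1 (by simp)

lemma IsLine.expansionAt_eq (hL : IsLine L) :
    expansionAt v L = Polynomial.C (C (eval v L)) + Polynomial.X * Polynomial.C L := by
  obtain ⟨a, -, rfl⟩ := hL.exists_eq_linear
  simp only [expansionAt, map_sum, map_mul, aeval_X, eval_C, eval_X, algHom_C,
    Polynomial.algebraMap_apply, algebraMap_eq, Finset.mul_sum, ← Finset.sum_add_distrib]
  exact Finset.sum_congr rfl fun i _ => by ring

lemma IsLine.X_pow_dvd_expansionAt_of_mul (hL : IsLine L)
    (h : Polynomial.X ^ n ∣ expansionAt v (L * G)) :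
    Polynomial.X ^ (n - 1) ∣ expansionAt v G := by
  rw [map_mul, hL.expansionAt_eq] at h
  by_cases hv : eval v L = 0
  · cases n with
    | zero => simp
    | succ n =>
      rw [hv, map_zero, map_zero, zero_add, pow_succ', mul_assoc,
        mul_dvd_mul_iff_left Polynomial.X_ne_zero] at h
      refine Polynomial.prime_X.pow_dvd_of_dvd_mul_left _ ?_ h
      simpa [Polynomial.X_dvd_iff] using hL.1
  · refine (pow_dvd_pow _ (n.sub_le 1)).trans
      (Polynomial.prime_X.pow_dvd_of_dvd_mul_left _ ?_ h)
    simpa [Polynomial.X_dvd_iff] using hv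

lemma IsLine.X_pow_dvd_expansionAt_of_mul_of_eval_ne_zero (hL : IsLine L) (hv : eval v L ≠ 0)
    (h : Polynomial.X ^ n ∣ expansionAt v (L * G)) : Polynomial.X ^ n ∣ expansionAt v G := by
  rw [map_mul, hL.expansionAt_eq] at h
  refine Polynomial.prime_X.pow_dvd_of_dvd_mul_left _ ?_ h
  simpa [Polynomial.X_dvd_iff] using hv

end Vanishing

section Bezout

variable {d : ℕ} {F G L : MvPolynomial (Fin 3) ℂ}

/-- `F` vanishes to order at least `n` at the point `x`, in terms of the expansions of `F` at the
representatives of `x`. -/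
def ExpansionVanishes (n : ℕ) (F : MvPolynomial (Fin 3) ℂ) (x : ℙ ℂ (Fin 3 → ℂ)) : Prop :=
  ∀ (v : Fin 3 → ℂ) (hv : v ≠ 0), Projectivization.mk ℂ v hv = x →
    Polynomial.X ^ n ∣ expansionAt v F

lemma eval_smul_of_isHomogeneous (hF : F.IsHomogeneous d) (c : ℂ) (v : Fin 3 → ℂ) :
    eval (c • v) F = c ^ d * eval v F := by
  rw [eval_eq, eval_eq, Finset.mul_sum]
  refine Finset.sum_congr rfl fun s hs => ?_
  rw [hF.degree_eq_sum_deg_support hs, ← Finset.prod_pow_eq_pow_sum]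
  simp only [Pi.smul_apply, smul_eq_mul, mul_pow, Finset.prod_mul_distrib]
  ring

/-- The restriction `F (v + T • u)` of `F` to the affine line through `v` with direction `u`, as a
polynomial in `T`. -/
noncomputable def lineRestriction (v u : Fin 3 → ℂ) : MvPolynomial (Fin 3) ℂ →ₐ[ℂ] Polynomial ℂ :=
  MvPolynomial.aeval fun i => Polynomial.C (v i) + Polynomial.X * Polynomial.C (u i)

lemma natDegree_lineRestriction_le (hF : F.IsHomogeneous d) (v u : Fin 3 → ℂ) :
    (lineRestriction v u F).natDegree ≤ d := by
  rw [lineRestriction, MvPolynomial.aeval_def, eval₂_eq]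
  refine Polynomial.natDegree_sum_le_of_forall_le _ _ fun s hs => ?_
  refine (Polynomial.natDegree_C_mul_le _ _).trans ((Polynomial.natDegree_prod_le _ _).trans ?_)
  rw [hF.degree_eq_sum_deg_support hs]
  refine Finset.sum_le_sum fun i _ => Polynomial.natDegree_pow_le.trans ?_
  have h : (Polynomial.C (v i) + Polynomial.X * Polynomial.C (u i)).natDegree ≤ 1 := by
    compute_degree
  simpa using Nat.mul_le_mul_left (s i) h

lemma eval_lineRestriction (v u : Fin 3 → ℂ) (c : ℂ) :
    (lineRestriction v u F).eval c = eval (v + c • u) F := by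
  induction F using MvPolynomial.induction_on with
  | C a => simp [lineRestriction]
  | add p q hp hq => simp [hp, hq]
  | mul_X p j hp =>
    rw [map_mul, map_mul, Polynomial.eval_mul, hp]
    simp [lineRestriction, mul_comm c]

lemma lineRestriction_comp (v u : Fin 3 → ℂ) (c : ℂ) :
    (lineRestriction v u F).comp (Polynomial.X + Polynomial.C c) =
      (expansionAt (v + c • u) F).map (eval u) := by
  induction F using MvPolynomial.induction_on with
  | C a => simp [lineRestriction, expansionAt]
  | add p q hp hq => simp [hp, hq]
  | mul_X p j hp =>
    rw [map_mul, map_mul, Polynomial.mul_comp, Polynomial.map_mul, hp]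
    congr 1
    simp [lineRestriction, expansionAt]
    ring

lemma IsLine.prime (hL : IsLine L) : Prime L := by
  refine (irreducible_of_totalDegree_eq_one (hL.2.totalDegree hL.1) fun x hx => ?_).prime
  obtain ⟨i, hi⟩ := ne_zero_iff.1 hL.1
  exact (ne_zero_of_dvd_ne_zero hi (hx i)).isUnit

lemma IsLine.dvd_of_eval_eq_zero (hL : IsLine L) (h : ∀ v, eval v L = 0 → eval v F = 0) :
    L ∣ F := by
  have hprime : (Ideal.span {L}).IsPrime := (Ideal.span_singleton_prime hL.1).2 hL.prime
  rw [← Ideal.mem_span_singleton, ← IsPrime.vanishingIdeal_zeroLocus (K := ℂ) (Ideal.span {L}),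
    mem_vanishingIdeal_iff]
  intro v hv
  rw [mem_zeroLocus_iff] at hv
  have hLv := hv L (Ideal.mem_span_singleton_self L)
  simpa [aeval_eq_eval] using h v (by simpa [aeval_eq_eval] using hLv)

lemma exists_eq_smul_cross {a b y : Fin 3 → ℂ} (hab : crossProduct a b ≠ 0)
    (ha : a ⬝ᵥ y = 0) (hb : b ⬝ᵥ y = 0) : ∃ t : ℂ, y = t • crossProduct a b := by
  have h : crossProduct (crossProduct a b) y = 0 := by
    rw [cross_cross_eq_smul_sub_smul, ha, hb]
    simp
  by_contra! hne
  refine crossProduct_ne_zero_iff_linearIndependent.2 ?_ h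
  exact (LinearIndependent.pair_iff' hab).2 fun t ht => hne t ht.symm

/-- Bézout's theorem for a line: a form of degree `d` that vanishes at points of a line to orders
adding up to more than `d` is divisible by the equation of the line. -/
lemma IsLine.dvd_of_lt_sum {ι : Type*} [Finite ι] (hL : IsLine L) (hF : F.IsHomogeneous d)
    {p : ι → ℙ ℂ (Fin 3 → ℂ)} (hp : Function.Injective p) (s : Finset ι) (m : ι → ℕ)
    (hmem : ∀ i ∈ s, MemLine L (p i)) (hvan : ∀ i ∈ s, ExpansionVanishes (m i) F (p i))
    (hlt : d < ∑ i ∈ s, m i) : L ∣ F := by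
  obtain ⟨f, hf⟩ := Module.exists_dual_forall_apply_ne_zero (K := ℂ) (fun i => (p i).rep)
    fun i => (p i).rep_nonzero
  obtain ⟨a, ha, rfl⟩ := hL.exists_eq_linear
  have hLeval (v : Fin 3 → ℂ) : eval v (∑ i, C (a i) * X i) = a ⬝ᵥ v := by simp [dotProduct]
  set b : Fin 3 → ℂ := fun i => f (Pi.single i 1) with hb
  have hfb (v : Fin 3 → ℂ) : f v = b ⬝ᵥ v := by
    conv_lhs => rw [← Finset.univ_sum_single v, map_sum]
    refine Finset.sum_congr rfl fun i _ => ?_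
    have h : (Pi.single i (v i) : Fin 3 → ℂ) = v i • Pi.single i 1 := by
      rw [← Pi.single_smul', smul_eq_mul, mul_one]
    rw [h, map_smul, smul_eq_mul, mul_comm]
  set v : ι → Fin 3 → ℂ := fun i => (f (p i).rep)⁻¹ • (p i).rep with hv
  have hv0 (i) : v i ≠ 0 := smul_ne_zero (inv_ne_zero (hf i)) (p i).rep_nonzero
  have hvp (i) : Projectivization.mk ℂ (v i) (hv0 i) = p i := by
    conv_rhs => rw [← (p i).mk_rep]
    rw [Projectivization.mk_eq_mk_iff']
    exact ⟨_, rfl⟩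
  have hbv (i) : b ⬝ᵥ v i = 1 := by
    rw [← hfb, hv, map_smul, smul_eq_mul, inv_mul_cancel₀ (hf i)]
  have hav (i) (hi : i ∈ s) : a ⬝ᵥ v i = 0 := by
    rw [← hLeval]
    exact hmem i hi _ (hv0 i) (hvp i)
  obtain ⟨i₀, hi₀⟩ : s.Nonempty := by
    rw [Finset.nonempty_iff_ne_empty]
    rintro rfl
    simp at hlt
  set u := crossProduct a b with hu
  have hu0 : u ≠ 0 := by
    intro h0
    have : ¬ LinearIndependent ℂ ![a, b] := fun hli =>
      crossProduct_ne_zero_iff_linearIndependent.2 hli h0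
    rw [LinearIndependent.pair_iff' ha] at this
    push Not at this
    obtain ⟨t, ht⟩ := this
    have h1 := hbv i₀
    rw [← ht, smul_dotProduct, hav i₀ hi₀, smul_zero] at h1
    exact zero_ne_one h1
  have hparam (x : Fin 3 → ℂ) (hax : a ⬝ᵥ x = 0) (hbx : b ⬝ᵥ x = 1) :
      ∃ t : ℂ, x = v i₀ + t • u := by
    obtain ⟨t, ht⟩ := exists_eq_smul_cross (y := x - v i₀) hu0
      (by rw [dotProduct_sub, hax, hav i₀ hi₀, sub_zero])
      (by rw [dotProduct_sub, hbx, hbv, sub_self])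
    exact ⟨t, by rw [← ht]; abel⟩
  choose! t ht using fun i hi => hparam (v i) (hav i hi) (hbv i)
  set g : Polynomial ℂ := lineRestriction (v i₀) u F
  have hgdeg : g.natDegree ≤ d := natDegree_lineRestriction_le hF _ _
  have hgdvd (i) (hi : i ∈ s) : (Polynomial.X - Polynomial.C (t i)) ^ m i ∣ g := by
    rw [Polynomial.X_sub_C_pow_dvd_iff, lineRestriction_comp, ← ht i hi]
    simpa using Polynomial.map_dvd (eval u) (hvan i hi _ (hv0 i) (hvp i))
  have hprod : ∏ i ∈ s, (Polynomial.X - Polynomial.C (t i)) ^ m i ∣ g := by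
    refine Finset.prod_dvd_of_coprime (fun i hi j hj hij => ?_) hgdvd
    refine (Polynomial.isCoprime_X_sub_C_of_isUnit_sub ?_).pow
    rw [isUnit_iff_ne_zero, sub_ne_zero]
    intro htij
    refine hij (hp ?_)
    rw [← hvp, ← hvp]
    congr 1
    rw [ht i hi, ht j hj, htij]
  have hg0 : g = 0 := by
    by_contra hne
    have h := Polynomial.natDegree_le_of_dvd hprod hne
    rw [Polynomial.natDegree_prod_of_monic _ _ fun i _ => (Polynomial.monic_X_sub_C _).pow _] at h
    simp only [Polynomial.natDegree_pow, Polynomial.natDegree_X_sub_C, mul_one] at h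
    omega
  have hmul : (∑ i, C (a i) * X i) ∣ F * ∑ i, C (b i) * X i := by
    refine hL.dvd_of_eval_eq_zero fun x hx => ?_
    rw [hLeval] at hx
    have hbeval : eval x (∑ i, C (b i) * X i) = b ⬝ᵥ x := by simp [dotProduct]
    rw [map_mul, hbeval]
    rcases eq_or_ne (b ⬝ᵥ x) 0 with hbx | hbx
    · rw [hbx, mul_zero]
    · obtain ⟨c, hc⟩ := hparam ((b ⬝ᵥ x)⁻¹ • x) (by rw [dotProduct_smul, hx, smul_zero])
        (by rw [dotProduct_smul, smul_eq_mul, inv_mul_cancel₀ hbx])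
      have hx' : x = (b ⬝ᵥ x) • (v i₀ + c • u) := by rw [← hc, smul_inv_smul₀ hbx]
      rw [hx', eval_smul_of_isHomogeneous hF, ← eval_lineRestriction (v i₀) u c,
        show lineRestriction (v i₀) u F = 0 from hg0, Polynomial.eval_zero, mul_zero, zero_mul]
  refine (hL.prime.dvd_or_dvd hmul).resolve_right fun ⟨q, hq⟩ => ?_
  have h := congr_arg (eval (v i₀)) hq
  rw [map_mul, hLeval, hav i₀ hi₀, zero_mul] at h
  refine one_ne_zero (α := ℂ) ?_
  rw [← hbv i₀, ← h]
  simp [dotProduct]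

end Bezout

section WeightedBound

variable {d m : ℕ} {F G L : MvPolynomial (Fin 3) ℂ} {Z : Set (ℙ ℂ (Fin 3 → ℂ))}

lemma IsLine.isHomogeneous_of_mul (hL : IsLine L) (h : (L * G).IsHomogeneous d) (hG : G ≠ 0) :
    ∃ e, d = e + 1 ∧ G.IsHomogeneous e := by
  let _ := MvPolynomial.gradedAlgebra (σ := Fin 3) (R := ℂ)
  have hself : (DirectSum.decompose (homogeneousSubmodule (Fin 3) ℂ) (L * G) d :
      MvPolynomial (Fin 3) ℂ) = L * G :=
    DirectSum.decompose_of_mem_same _ ((mem_homogeneousSubmodule _ _).2 h)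
  have hL1 := (mem_homogeneousSubmodule _ _).2 hL.2
  cases d with
  | zero =>
    rw [DirectSum.coe_decompose_mul_of_left_mem_of_not_le _ hL1 (by norm_num)] at hself
    exact absurd hself.symm (mul_ne_zero hL.1 hG)
  | succ e =>
    rw [DirectSum.coe_decompose_mul_of_left_mem_of_le _ hL1 (by omega), add_tsub_cancel_right]
      at hself
    rw [← mul_left_cancel₀ hL.1 hself]
    exact ⟨e, rfl, (mem_homogeneousSubmodule _ _).1 (SetLike.coe_mem _)⟩

lemma IsLine.expansionVanishes_of_mul (hL : IsLine L) {x : ℙ ℂ (Fin 3 → ℂ)}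
    (h : ExpansionVanishes m (L * G) x) : ExpansionVanishes (m - 1) G x :=
  fun v hv hx => hL.X_pow_dvd_expansionAt_of_mul (h v hv hx)

/-- The line `L` contains the point `x` as soon as it contains one representative of `x`. -/
lemma memLine_mk (hL : F.IsHomogeneous d) {v : Fin 3 → ℂ} (hv : v ≠ 0) (h : eval v F = 0) :
    MemLine F (Projectivization.mk ℂ v hv) := by
  intro w hw hwv
  obtain ⟨c, rfl⟩ := (Projectivization.mk_eq_mk_iff' ℂ _ _ _ _).1 hwv
  rw [eval_smul_of_isHomogeneous hL, h, mul_zero]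

lemma IsLine.expansionVanishes_of_mul_of_not_memLine (hL : IsLine L) {x : ℙ ℂ (Fin 3 → ℂ)}
    (hx : ¬ MemLine L x) (h : ExpansionVanishes m (L * G) x) : ExpansionVanishes m G x := by
  rintro v hv rfl
  exact hL.X_pow_dvd_expansionAt_of_mul_of_eval_ne_zero (fun h0 => hx (memLine_mk hL.2 hv h0))
    (h v hv rfl)

/-- A weighted multiplicity bound. Given lines `ℓ j` and points `p i` with weights `w i` such that
`p i` lies on at least `w i` of the lines and the points on each line have total weight at most the
number of lines, the weighted sum of the vanishing orders of a form at the points is at most the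
number of lines times its degree. -/
lemma sum_weight_mul_le {ι κ : Type*} [Fintype ι] [Fintype κ]
    {p : ι → ℙ ℂ (Fin 3 → ℂ)} (hp : Function.Injective p)
    {ℓ : κ → MvPolynomial (Fin 3) ℂ} (hℓ : ∀ j, IsLine (ℓ j))
    {I : ι → κ → Bool} (hI : ∀ i j, MemLine (ℓ j) (p i) ↔ I i j)
    {w : ι → ℕ} (hw : ∀ i, w i ≤ ∑ j, if I i j then 1 else 0)
    (hwℓ : ∀ j, (∑ i, if I i j then w i else 0) ≤ Fintype.card κ)
    (hF : F.IsHomogeneous d) (hF0 : F ≠ 0) {m : ι → ℕ}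
    (hm : ∀ i, ExpansionVanishes (m i) F (p i)) :
    ∑ i, w i * m i ≤ Fintype.card κ * d := by
  induction d using Nat.strong_induction_on generalizing F m with
  | _ d ih =>
    by_contra! hlt
    have hsum : ∑ _j : κ, d < ∑ j, ∑ i, if I i j then m i else 0 := by
      rw [Finset.sum_const, Finset.card_univ, smul_eq_mul, Finset.sum_comm]
      refine hlt.trans_le (Finset.sum_le_sum fun i _ => ?_)
      refine (Nat.mul_le_mul_right (m i) (hw i)).trans_eq ?_
      simp only [Finset.sum_mul, ite_mul, one_mul, zero_mul]
    obtain ⟨j, -, hj⟩ := Finset.exists_lt_of_sum_lt hsum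
    rw [← Finset.sum_filter] at hj
    obtain ⟨G, rfl⟩ := (hℓ j).dvd_of_lt_sum hF hp _ m
      (fun i hi => (hI i j).2 (Finset.mem_filter.1 hi).2) (fun i _ => hm i) hj
    have hG0 : G ≠ 0 := right_ne_zero_of_mul hF0
    obtain ⟨e, rfl, hG⟩ := (hℓ j).isHomogeneous_of_mul hF hG0
    have hind : ∑ i, w i * (if I i j then m i - 1 else m i) ≤ Fintype.card κ * e :=
      ih e e.lt_succ_self hG hG0 fun i => by
        by_cases hij : I i j
        · simpa [hij] using (hℓ j).expansionVanishes_of_mul (hm i)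
        · simpa [hij] using (hℓ j).expansionVanishes_of_mul_of_not_memLine
            (mt (hI i j).1 hij) (hm i)
    have hle : ∑ i, w i * m i ≤ ∑ i, w i * (if I i j then m i - 1 else m i) +
        ∑ i, if I i j then w i else 0 := by
      rw [← Finset.sum_add_distrib]
      refine Finset.sum_le_sum fun i _ => ?_
      split_ifs
      · rw [← Nat.mul_add_one]
        exact Nat.mul_le_mul_left _ (by omega)
      · omega
    have := hwℓ j
    rw [Nat.mul_add_one] at hlt
    omega

lemma MemLine.vanishesToOrder_one {x : ℙ ℂ (Fin 3 → ℂ)} (h : MemLine L x) {v : Fin 3 → ℂ}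
    (hv : v ≠ 0) (hx : Projectivization.mk ℂ v hv = x) : VanishesToOrder 1 L v :=
  vanishesToOrder_succ.2 ⟨h v hv hx, fun _ => vanishesToOrder_zero⟩

/-- A product of powers of lines lies in a symbolic power when the exponents of the lines through
each point add up to enough. -/
lemma exists_mem_symbolicPower {ι κ : Type*} [Fintype κ]
    {p : ι → ℙ ℂ (Fin 3 → ℂ)} (hZ : Z = Set.range p)
    {ℓ : κ → MvPolynomial (Fin 3) ℂ} (hℓ : ∀ j, IsLine (ℓ j))
    {I : ι → κ → Bool} (hI : ∀ i j, MemLine (ℓ j) (p i) ↔ I i j)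
    (e : κ → ℕ) (he : ∀ i, m ≤ ∑ j, if I i j then e j else 0) :
    ∃ F ∈ symbolicPower Z m, F ≠ 0 ∧ F.IsHomogeneous (∑ j, e j) := by
  refine ⟨∏ j, ℓ j ^ e j, ?_, Finset.prod_ne_zero_iff.2 fun j _ => pow_ne_zero _ (hℓ j).1, ?_⟩
  · subst hZ
    rintro _ ⟨i, rfl⟩ v hv hvi
    refine VanishesToOrder.mono (VanishesToOrder.prod _ fun j _ => ?_) (he i)
    split_ifs with hij
    · simpa using (((hI i j).2 hij).vanishesToOrder_one hv hvi).pow (e j)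
    · exact vanishesToOrder_zero
  · exact IsHomogeneous.prod _ _ _ fun j _ => by simpa using (hℓ j).2.pow (e j)

end WeightedBound

section Incidence

variable {L M : MvPolynomial (Fin 3) ℂ} {x y z : ℙ ℂ (Fin 3 → ℂ)}

lemma MemLine.expansionVanishes_one (h : MemLine L x) : ExpansionVanishes 1 L x :=
  fun _ hv hx => (h.vanishesToOrder_one hv hx).X_pow_dvd_expansionAt

lemma MemLine.of_dvd (hdvd : L ∣ M) (h : MemLine L x) : MemLine M x := by
  obtain ⟨G, rfl⟩ := hdvd
  intro v hv hx
  rw [map_mul, h v hv hx, zero_mul]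

/-- Two lines sharing two distinct points coincide. -/
lemma IsLine.memLine_of_ne (hL : IsLine L) (hM : IsLine M) (hxy : x ≠ y)
    (hLx : MemLine L x) (hLy : MemLine L y) (hMx : MemLine M x) (hMy : MemLine M y)
    (hLz : MemLine L z) : MemLine M z := by
  refine hLz.of_dvd (hL.dvd_of_lt_sum hM.2 (p := ![x, y]) ?_ Finset.univ 1 ?_ ?_ (by simp))
  · intro i j
    fin_cases i <;> fin_cases j <;> simp [hxy, hxy.symm]
  · simpa [Fin.forall_fin_two] using ⟨hLx, hLy⟩
  · simpa [Fin.forall_fin_two] using ⟨hMx.expansionVanishes_one, hMy.expansionVanishes_one⟩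

/-- Two distinct lines meet in at most one point. -/
lemma IsLine.memLine_iff_eq (hL : IsLine L) (hM : IsLine M) (hLx : MemLine L x)
    (hMx : MemLine M x) (hMz : MemLine M z) (hLz : ¬ MemLine L z) (hLy : MemLine L y) :
    MemLine M y ↔ y = x := by
  refine ⟨fun hMy => ?_, fun h => h ▸ hMx⟩
  by_contra hyx
  exact hLz (hM.memLine_of_ne hL hyx hMy hMx hLy hLx hMz)

lemma exists_isLine_through (hxy : x ≠ y) : ∃ M, IsLine M ∧ MemLine M x ∧ MemLine M y := by
  induction x with | h v hv =>
  induction y with | h u hu =>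
  have hcross : crossProduct v u ≠ 0 := by
    rw [crossProduct_ne_zero_iff_linearIndependent, LinearIndependent.pair_iff' hv]
    intro a ha
    exact hxy ((Projectivization.mk_eq_mk_iff' ℂ _ _ _ _).2 ⟨a, ha⟩).symm
  set a := crossProduct v u with ha
  have heval (w : Fin 3 → ℂ) : eval w (∑ i, C (a i) * X i) = w ⬝ᵥ a := by
    simp [dotProduct, mul_comm]
  have hhom : (∑ i, C (a i) * X i).IsHomogeneous 1 :=
    IsHomogeneous.sum _ _ _ fun i _ => isHomogeneous_C_mul_X _ _
  refine ⟨_, ⟨fun h0 => hcross ?_, hhom⟩, memLine_mk hhom hv ?_, memLine_mk hhom hu ?_⟩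
  · funext i
    have := heval (Pi.single i 1)
    rw [h0] at this
    simpa using this.symm
  · rw [heval, ha, dot_self_cross]
  · rw [heval, ha, dot_cross_self]

end Incidence

section Configuration

variable {m t : ℕ} {Z : Set (ℙ ℂ (Fin 3 → ℂ))}

/-- The incidence table of the configuration: the rows are the points `P, A, B, Q₁, Q₂, C, D`, where
`D` is the fourth point on `L`, and the columns are the lines `L, L₁, L₂, L₃, DP, DA, DB`. -/
def configIncidence : Fin 7 → Fin 7 → Bool :=
  ![![false, true, true, false, true, false, false],
    ![false, true, false, true, false, true, false],
    ![false, false, true, true, false, false, true],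
    ![true, true, false, false, false, false, false],
    ![true, false, true, false, false, false, false],
    ![true, false, false, true, false, false, false],
    ![true, false, false, false, true, true, true]]

/-- `Z` consists of seven points lying on seven lines according to `configIncidence`. -/
def HasConfigIncidence (Z : Set (ℙ ℂ (Fin 3 → ℂ))) : Prop :=
  ∃ (p : Fin 7 → ℙ ℂ (Fin 3 → ℂ)) (ℓ : Fin 7 → MvPolynomial (Fin 3) ℂ),
    Function.Injective p ∧ Z = Set.range p ∧ (∀ j, IsLine (ℓ j)) ∧
      ∀ i j, MemLine (ℓ j) (p i) ↔ configIncidence i j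

lemma StandardConfig.hasConfigIncidence (hfin : Z.Finite) (hcard : Z.ncard = 7)
    (hconf : StandardConfig 4 Z) : HasConfigIncidence Z := by
  obtain ⟨L, L₁, L₂, L₃, Q₁, Q₂, C, P, A, B, hL, hL₁, hL₂, hL₃, hQ₁Z, hQ₂Z, hCZ, hPZ, hAZ, hBZ,
    hQ₁Q₂, hQ₁C, hQ₂C, hLQ₁, hLQ₂, hLC, hLcard, hLP, hL₁P, hL₁Q₁, hL₁A, hAP, hAQ₁, hLA,
    hL₂P, hL₂Q₂, hL₂B, hBP, hBQ₂, hLB, hL₃A, hL₃B, hL₃C, -⟩ := hconf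
  obtain ⟨D, ⟨hDZ, hLD⟩, hD⟩ : ∃ D ∈ Z ∩ {x | MemLine L x}, D ∉ ({Q₁, Q₂, C} : Set _) := by
    refine Set.exists_mem_notMem_of_ncard_lt_ncard ?_ (Set.toFinite _)
    rw [hLcard, Set.ncard_eq_three.2 ⟨_, _, _, hQ₁Q₂, hQ₁C, hQ₂C, rfl⟩]
    norm_num
  simp only [Set.mem_insert_iff, Set.mem_singleton_iff, not_or] at hD
  obtain ⟨hDQ₁, hDQ₂, hDC⟩ := hD
  change MemLine L D at hLD
  have hne {x y} (hx : ¬ MemLine L x) (hy : MemLine L y) : x ≠ y := fun h => hx (h ▸ hy)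
  obtain ⟨MP, hMP, hMPP, hMPD⟩ := exists_isLine_through (hne hLP hLD)
  obtain ⟨MA, hMA, hMAA, hMAD⟩ := exists_isLine_through (hne hLA hLD)
  obtain ⟨MB, hMB, hMBB, hMBD⟩ := exists_isLine_through (hne hLB hLD)
  have h₁ {y} (hy : MemLine L y) := hL.memLine_iff_eq hL₁ hLQ₁ hL₁Q₁ hL₁P hLP hy
  have h₂ {y} (hy : MemLine L y) := hL.memLine_iff_eq hL₂ hLQ₂ hL₂Q₂ hL₂P hLP hy
  have h₃ {y} (hy : MemLine L y) := hL.memLine_iff_eq hL₃ hLC hL₃C hL₃A hLA hy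
  have hP {y} (hy : MemLine L y) := hL.memLine_iff_eq hMP hLD hMPD hMPP hLP hy
  have hA {y} (hy : MemLine L y) := hL.memLine_iff_eq hMA hLD hMAD hMAA hLA hy
  have hB {y} (hy : MemLine L y) := hL.memLine_iff_eq hMB hLD hMBD hMBB hLB hy
  have hL₁D : ¬ MemLine L₁ D := by rwa [h₁ hLD]
  have hL₂D : ¬ MemLine L₂ D := by rwa [h₂ hLD]
  have hL₃D : ¬ MemLine L₃ D := by rwa [h₃ hLD]
  have hL₂Q₁ : ¬ MemLine L₂ Q₁ := by rwa [h₂ hLQ₁]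
  have hL₁Q₂ : ¬ MemLine L₁ Q₂ := by rwa [h₁ hLQ₂, eq_comm]
  have hL₁C : ¬ MemLine L₁ C := by rwa [h₁ hLC, eq_comm]
  have hL₁B : ¬ MemLine L₁ B := by rwa [hL₂.memLine_iff_eq hL₁ hL₂P hL₁P hL₁Q₁ hL₂Q₁ hL₂B]
  have hL₂A : ¬ MemLine L₂ A := by rwa [hL₁.memLine_iff_eq hL₂ hL₁P hL₂P hL₂Q₂ hL₁Q₂ hL₁A]
  have hAB : A ≠ B := fun h => hL₂A (h ▸ hL₂B)
  have hL₃P : ¬ MemLine L₃ P := by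
    rwa [hL₁.memLine_iff_eq hL₃ hL₁A hL₃A hL₃C hL₁C hL₁P, eq_comm]
  have hMPA : ¬ MemLine MP A := by rwa [hL₁.memLine_iff_eq hMP hL₁P hMPP hMPD hL₁D hL₁A]
  have hMPB : ¬ MemLine MP B := by rwa [hL₂.memLine_iff_eq hMP hL₂P hMPP hMPD hL₂D hL₂B]
  have hMAP : ¬ MemLine MA P := by rwa [hL₁.memLine_iff_eq hMA hL₁A hMAA hMAD hL₁D hL₁P, eq_comm]
  have hMAB : ¬ MemLine MA B := by rwa [hL₃.memLine_iff_eq hMA hL₃A hMAA hMAD hL₃D hL₃B, eq_comm]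
  have hMBP : ¬ MemLine MB P := by rwa [hL₂.memLine_iff_eq hMB hL₂B hMBB hMBD hL₂D hL₂P, eq_comm]
  have hMBA : ¬ MemLine MB A := by rwa [hL₃.memLine_iff_eq hMB hL₃B hMBB hMBD hL₃D hL₃A]
  have hinc : ∀ i j, MemLine (![L, L₁, L₂, L₃, MP, MA, MB] j) (![P, A, B, Q₁, Q₂, C, D] i) ↔
      configIncidence i j := by
    simp [Fin.forall_fin_succ, configIncidence, hQ₁Q₂.symm, hQ₁C.symm, hQ₂C.symm,
      Ne.symm hDQ₁, Ne.symm hDQ₂, Ne.symm hDC, *]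
  have hinj : Function.Injective ![P, A, B, Q₁, Q₂, C, D] := by
    have hrows : ∀ i i', configIncidence i = configIncidence i' → i = i' := by decide
    refine fun i i' h => hrows i i' (funext fun j => ?_)
    rw [Bool.eq_iff_iff, ← hinc, ← hinc, h]
  refine ⟨![P, A, B, Q₁, Q₂, C, D], ![L, L₁, L₂, L₃, MP, MA, MB], hinj, ?_, ?_, hinc⟩
  · refine (Set.eq_of_subset_of_ncard_le ?_ ?_ hfin).symm
    · rintro _ ⟨i, rfl⟩
      fin_cases i <;> assumption
    · rw [hcard, ← Set.image_univ, Set.ncard_image_of_injective _ hinj]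
      simp
  · simp [Fin.forall_fin_succ, *]

lemma HasConfigIncidence.sixteen_mul_le (hZ : HasConfigIncidence Z) {F : MvPolynomial (Fin 3) ℂ}
    (hF : F ∈ symbolicPower Z m) (hF0 : F ≠ 0) (hFt : F.IsHomogeneous t) : 16 * m ≤ 7 * t := by
  obtain ⟨p, ℓ, hp, rfl, hℓ, hI⟩ := hZ
  have h := sum_weight_mul_le hp hℓ hI (w := ![3, 3, 3, 1, 1, 1, 4]) (by decide) (by decide)
    hFt hF0 (m := fun _ => m)
    fun i v hv hvi => (hF (p i) ⟨i, rfl⟩ v hv hvi).X_pow_dvd_expansionAt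
  rw [← Finset.sum_mul] at h
  simpa [Fin.sum_univ_succ] using h

lemma HasConfigIncidence.exists_mem (hZ : HasConfigIncidence Z) (e : Fin 7 → ℕ)
    (he : ∀ i, m ≤ ∑ j, if configIncidence i j then e j else 0) :
    ∃ F ∈ symbolicPower Z m, F ≠ 0 ∧ F.IsHomogeneous (∑ j, e j) := by
  obtain ⟨p, ℓ, -, hZp, hℓ, hI⟩ := hZ
  exact exists_mem_symbolicPower hZp hℓ hI e he

lemma HasConfigIncidence.sixteen_mul_le_initialDegree (hZ : HasConfigIncidence Z) (m : ℕ) :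
    16 * m ≤ 7 * initialDegree (symbolicPower Z m) := by
  have hne : {t | ∃ F ∈ symbolicPower Z m, F ≠ 0 ∧ F.IsHomogeneous t}.Nonempty :=
    ⟨_, hZ.exists_mem (fun _ => m) fun i => by
      fin_cases i <;> simp [configIncidence, Fin.sum_univ_succ]⟩
  obtain ⟨F, hF, hF0, hFt⟩ := Nat.sInf_mem hne
  exact hZ.sixteen_mul_le hF hF0 hFt

lemma HasConfigIncidence.initialDegree_eq (hZ : HasConfigIncidence Z) (e : Fin 7 → ℕ)
    (he : ∀ i, m ≤ ∑ j, if configIncidence i j then e j else 0) (het : ∑ j, e j = t)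
    (ht : 7 * t < 16 * m + 7) : initialDegree (symbolicPower Z m) = t := by
  have hle : initialDegree (symbolicPower Z m) ≤ t := Nat.sInf_le (het ▸ hZ.exists_mem e he)
  have := hZ.sixteen_mul_le_initialDegree m
  omega

/-- The exponents `k • (4, 3, 3, 3, 1, 1, 1) + (a, b, b, c, f, 0, 0)` of the lines. -/
lemma HasConfigIncidence.initialDegree_eq_of_periodic (hZ : HasConfigIncidence Z)
    (k a b c f : ℕ) (hP : m ≤ 7 * k + (2 * b + f)) (hA : m ≤ 7 * k + (b + c))
    (hQ : m ≤ 7 * k + (a + b)) (hC : m ≤ 7 * k + (a + c)) (hD : m ≤ 7 * k + (a + f))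
    (ht : t = 16 * k + (a + 2 * b + c + f)) (htm : 7 * t < 16 * m + 7) :
    initialDegree (symbolicPower Z m) = t := by
  refine hZ.initialDegree_eq
    ![4 * k + a, 3 * k + b, 3 * k + b, 3 * k + c, k + f, k, k] (fun i => ?_) ?_ htm
  · fin_cases i <;> simp [configIncidence, Fin.sum_univ_succ] <;> omega
  · simp [Fin.sum_univ_succ]
    omega

end Configuration

/-- Configuration `H(7,17)`: a set of `7` points of `ℙ²` with a line containing exactly four of
them (as in `StandardConfig 4`) has Waldschmidt constant `16/7`, and the first differences of
the initial sequence are periodic with period `(3,2,2,3,2,2,2)`. -/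
theorem H7_17 (Z : Set (ℙ ℂ (Fin 3 → ℂ)))
    (hfin : Z.Finite) (hcard : Z.ncard = 7) (hconf : StandardConfig 4 Z) :
    waldschmidt Z = 16 / 7 ∧
    ∀ k : ℕ,
      initialDegree (symbolicPower Z (7 * k + 1)) = 16 * k + 3 ∧
      initialDegree (symbolicPower Z (7 * k + 2)) = 16 * k + 5 ∧
      initialDegree (symbolicPower Z (7 * k + 3)) = 16 * k + 7 ∧
      initialDegree (symbolicPower Z (7 * k + 4)) = 16 * k + 10 ∧
      initialDegree (symbolicPower Z (7 * k + 5)) = 16 * k + 12 ∧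
      initialDegree (symbolicPower Z (7 * k + 6)) = 16 * k + 14 ∧
      initialDegree (symbolicPower Z (7 * k + 7)) = 16 * k + 16 := by
  have hZ := hconf.hasConfigIncidence hfin hcard
  have hseven (k : ℕ) : initialDegree (symbolicPower Z (7 * k + 7)) = 16 * k + 16 :=
    hZ.initialDegree_eq_of_periodic (k + 1) 0 0 0 0 (by omega) (by omega) (by omega) (by omega)
      (by omega) (by omega) (by omega)
  constructor
  · have hbdd : BddBelow (Set.range fun m : ℕ+ =>
        (initialDegree (symbolicPower Z (m : ℕ)) : ℝ) / ((m : ℕ) : ℝ)) :=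
      ⟨0, by rintro _ ⟨m, rfl⟩; positivity⟩
    refine le_antisymm ((ciInf_le hbdd 7).trans_eq ?_) (le_ciInf fun m => ?_)
    · have h := hseven 0
      norm_num at h ⊢
      rw [h]
      norm_num
    · have hm : (0 : ℝ) < (m : ℕ) := by exact_mod_cast m.pos
      rw [div_le_div_iff₀ (by norm_num) hm, mul_comm _ (7 : ℝ)]
      exact_mod_cast hZ.sixteen_mul_le_initialDegree m
  · intro k
    refine ⟨hZ.initialDegree_eq_of_periodic k 1 1 0 0 ?_ ?_ ?_ ?_ ?_ ?_ ?_,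
      hZ.initialDegree_eq_of_periodic k 2 1 1 0 ?_ ?_ ?_ ?_ ?_ ?_ ?_,
      hZ.initialDegree_eq_of_periodic k 2 1 2 1 ?_ ?_ ?_ ?_ ?_ ?_ ?_,
      hZ.initialDegree_eq_of_periodic k 3 2 2 1 ?_ ?_ ?_ ?_ ?_ ?_ ?_,
      hZ.initialDegree_eq_of_periodic k 4 2 3 1 ?_ ?_ ?_ ?_ ?_ ?_ ?_,
      hZ.initialDegree_eq_of_periodic k 4 2 4 2 ?_ ?_ ?_ ?_ ?_ ?_ ?_, hseven k⟩ <;> omega
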